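/- Let T be a tree (a connected acyclic finite simple graph) on n ≥ 2 vertices with n_1 leaves (vertices of degree 1). Then the zero forcing number of T satisfies ⌈n_1 / 2⌉ ≤ F_1(T) ≤ n_1 - 1. -/

import Mathlib

open Finset SimpleGraph

/-- One round of the `k`-forcing color change rule: to the currently colored set `C` we add
every vertex `w` having a colored neighbor `v` with at most `k` non-colored neighbors. -/
def kForceStep {V : Type*} [Fintype V] [DecidableEq V] (G : SimpleGraph V)
    [DecidableRel G.Adj] (k : ℕ) (C : Finset V) : Finset V :=
  C ∪ Finset.univ.filter (fun w =>
    ∃ v ∈ C, G.Adj v w ∧ ((G.neighborFinset v) \ C).card ≤ k)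

/-- `S` is a `k`-forcing set: iterating the color change rule starting from `S`
eventually colors all vertices. -/
def IsKForcingSet {V : Type*} [Fintype V] [DecidableEq V] (G : SimpleGraph V)
    [DecidableRel G.Adj] (k : ℕ) (S : Finset V) : Prop :=
  (kForceStep G k)^[Fintype.card V] S = Finset.univ

/-- The `k`-forcing number: the minimum cardinality of a `k`-forcing set. -/
noncomputable def kForcingNumber {V : Type*} [Fintype V] [DecidableEq V] (G : SimpleGraph V)
    [DecidableRel G.Adj] (k : ℕ) : ℕ :=
  sInf {m | ∃ S : Finset V, IsKForcingSet G k S ∧ S.card = m}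

/-- In a tree, every vertex has at most one neighbor closer to a given root. -/
lemma SimpleGraph.IsTree.eq_of_adj_of_dist_eq {V : Type*} {G : SimpleGraph V} (hG : G.IsTree)
    {r a b c : V} (ha : G.Adj a c) (hb : G.Adj b c)
    (hda : G.dist r c = G.dist r a + 1) (hdb : G.dist r c = G.dist r b + 1) : a = b := by
  obtain ⟨p, hp⟩ := hG.connected.exists_walk_length_eq_dist r a
  obtain ⟨q, hq⟩ := hG.connected.exists_walk_length_eq_dist r b
  have hp' : (p.concat ha).IsPath :=
    Walk.isPath_of_length_eq_dist _ (by rw [Walk.length_concat, hp, hda])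
  have hq' : (q.concat hb).IsPath :=
    Walk.isPath_of_length_eq_dist _ (by rw [Walk.length_concat, hq, hdb])
  have h := congrArg (fun w : G.Path r c => (w : G.Walk r c).penultimate)
    ((hG.isAcyclic.subsingleton_path r c).elim ⟨_, hp'⟩ ⟨_, hq'⟩)
  simpa using h

section KForcing

variable {V : Type*} [Fintype V] [DecidableEq V] {G : SimpleGraph V} [DecidableRel G.Adj]

lemma subset_kForceStep (k : ℕ) (C : Finset V) : C ⊆ kForceStep G k C :=
  Finset.subset_union_left

lemma mem_kForceStep_of_adj {k : ℕ} {C : Finset V} {v w : V} (hv : v ∈ C) (hvw : G.Adj v w)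
    (hk : (G.neighborFinset v \ C).card ≤ k) : w ∈ kForceStep G k C :=
  Finset.mem_union_right _ (Finset.mem_filter.2 ⟨Finset.mem_univ _, v, hv, hvw, hk⟩)

lemma subset_iterate_kForceStep (k : ℕ) (S : Finset V) (i : ℕ) :
    S ⊆ (kForceStep G k)^[i] S := by
  induction i with
  | zero => exact subset_rfl
  | succ i ih =>
    rw [Function.iterate_succ_apply']
    exact ih.trans (subset_kForceStep k _)

/-- After `card V` rounds the coloring process is stationary. -/
lemma kForceStep_iterate_card (k : ℕ) (S : Finset V) :
    kForceStep G k ((kForceStep G k)^[Fintype.card V] S) =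
      (kForceStep G k)^[Fintype.card V] S := by
  have key : ∀ i : ℕ, kForceStep G k ((kForceStep G k)^[i] S) = (kForceStep G k)^[i] S ∨
      i ≤ ((kForceStep G k)^[i] S).card := by
    intro i
    induction i with
    | zero => exact Or.inr (Nat.zero_le _)
    | succ i ih =>
      rw [Function.iterate_succ_apply']
      by_cases hfix : kForceStep G k ((kForceStep G k)^[i] S) = (kForceStep G k)^[i] S
      · exact Or.inl (by rw [hfix, hfix])
      · have hlt := Finset.card_lt_card
          ((subset_kForceStep (G := G) k ((kForceStep G k)^[i] S)).ssubset_of_ne (Ne.symm hfix))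
        rcases ih with ih | ih
        · exact absurd ih hfix
        · right; omega
  rcases key (Fintype.card V) with h | h
  · exact h
  · have huniv := Finset.eq_univ_of_card _ (le_antisymm (Finset.card_le_univ _) h)
    rw [huniv]
    exact Finset.univ_subset_iff.1 (subset_kForceStep k _)

/-- If the only stationary superset of `S` is the whole vertex set, then `S` is forcing. -/
lemma isKForcingSet_of_forall_stationary {k : ℕ} {S : Finset V}
    (h : ∀ C, S ⊆ C → kForceStep G k C = C → C = Finset.univ) : IsKForcingSet G k S :=
  h _ (subset_iterate_kForceStep k S _) (kForceStep_iterate_card k S)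

lemma kForcingNumber_le_card {k : ℕ} {S : Finset V} (hS : IsKForcingSet G k S) :
    kForcingNumber G k ≤ S.card :=
  Nat.sInf_le ⟨S, hS, rfl⟩

lemma exists_isKForcingSet_card_eq_kForcingNumber (G : SimpleGraph V) [DecidableRel G.Adj]
    (k : ℕ) : ∃ S : Finset V, IsKForcingSet G k S ∧ S.card = kForcingNumber G k := by
  refine Nat.sInf_mem (s := {m | ∃ S : Finset V, IsKForcingSet G k S ∧ S.card = m})
    ⟨_, Finset.univ, ?_, rfl⟩
  exact Finset.univ_subset_iff.1 (subset_iterate_kForceStep k _ _)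

/-- In a tree, the set of all leaves but one is a zero forcing set. -/
lemma isKForcingSet_leaves_erase (hG : G.IsTree) [Nontrivial V] (r : V) :
    IsKForcingSet G 1 ((Finset.univ.filter (fun v : V => G.degree v = 1)).erase r) := by
  refine isKForcingSet_of_forall_stationary fun C hSC hC => ?_
  by_contra hne
  have hU : (Finset.univ \ C).Nonempty := by
    rw [Finset.sdiff_nonempty]
    exact fun h => hne (Finset.univ_subset_iff.1 h)
  obtain ⟨u, hu, hmax⟩ := Finset.exists_max_image _ (G.dist r) hU
  have huC : u ∉ C := (Finset.mem_sdiff.1 hu).2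
  have hfar : ∀ x, G.dist r u < G.dist r x → x ∈ C := fun x hx => by
    by_contra hxC
    exact absurd (hmax x (by simp [hxC])) (not_le.2 hx)
  obtain ⟨c, huc, hdc⟩ : ∃ c, G.Adj u c ∧ G.dist r c = G.dist r u + 1 := by
    by_contra! hno
    have hcloser : ∀ a, G.Adj u a → G.dist r u = G.dist r a + 1 := fun a ha =>
      (hG.dist_eq_dist_add_one_of_adj r ha).resolve_right (hno a ha)
    obtain ⟨a, ha⟩ := hG.connected.preconnected.exists_adj_of_nontrivial u
    have hleaf : G.degree u = 1 := degree_eq_one_iff_existsUnique_adj.2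
      ⟨a, ha, fun b hb => hG.eq_of_adj_of_dist_eq hb.symm ha.symm (hcloser b hb) (hcloser a ha)⟩
    have hur : u = r := by
      by_contra hur
      exact huC (hSC (by simp [hur, hleaf]))
    have := hcloser a ha
    simp [hur] at this
  have hforce : u ∈ kForceStep G 1 C := by
    refine mem_kForceStep_of_adj (hfar c (by omega)) huc.symm ?_
    refine Finset.card_le_one_iff_subset_singleton.2 ⟨u, fun x hx => ?_⟩
    obtain ⟨hcx, hxC⟩ := Finset.mem_sdiff.1 hx
    rw [mem_neighborFinset] at hcx
    rcases hG.dist_eq_dist_add_one_of_adj r hcx with h | h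
    · exact Finset.mem_singleton.2 (hG.eq_of_adj_of_dist_eq hcx.symm huc h hdc)
    · exact absurd (hfar x (by omega)) hxC
  exact huC (hC ▸ hforce)

/-- `E` contains the current ends of forcing chains that started in `S` and colored `C`. -/
structure IsChainEnds (G : SimpleGraph V) [DecidableRel G.Adj] (S C E : Finset V) : Prop where
  card_le : E.card ≤ S.card
  mem_of_adj : ∀ v ∈ C, v ∉ E → ∀ w, G.Adj v w → w ∈ C
  leaf_mem : ∀ v ∈ C, v ∉ S → G.degree v = 1 → v ∈ E
  exists_adj : ∀ v ∈ C, v ∉ S → ∃ u ∈ C, G.Adj v u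

lemma IsChainEnds.insert {S C E : Finset V} (h : IsChainEnds G S C E) {v w : V} (hv : v ∈ C)
    (hw : w ∉ C) (hvw : G.Adj v w) (hk : (G.neighborFinset v \ C).card ≤ 1) :
    IsChainEnds G S (insert w C) (insert w (E.erase v)) := by
  have hvE : v ∈ E := by
    by_contra hvE
    exact hw (h.mem_of_adj v hv hvE w hvw)
  have hcol : ∀ x, G.Adj v x → x ∉ C → x = w := fun x hx hxC =>
    Finset.card_le_one.1 hk x (by simp [hx, hxC]) w (by simp [hvw, hw])
  refine ⟨?_, ?_, ?_, ?_⟩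
  · have h1 := Finset.card_insert_le w (E.erase v)
    have h2 := Finset.card_erase_add_one hvE
    have h3 := h.card_le
    omega
  · intro x hx hxE y hxy
    have := h.mem_of_adj x
    have := hcol y
    grind
  · intro x hx hxS hdeg
    by_cases hxw : x = w
    · simp [hxw]
    have hxC : x ∈ C := (Finset.mem_insert.1 hx).resolve_left hxw
    have hxv : x ≠ v := by
      rintro rfl
      obtain ⟨u, huC, hu⟩ := h.exists_adj x hxC hxS
      exact hw ((degree_eq_one_iff_existsUnique_adj.1 hdeg).unique hu hvw ▸ huC)
    simp [hxv, h.leaf_mem x hxC hxS hdeg]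
  · intro x hx hxS
    rcases Finset.mem_insert.1 hx with rfl | hxC
    · exact ⟨v, Finset.mem_insert_of_mem hv, hvw.symm⟩
    · obtain ⟨u, huC, hu⟩ := h.exists_adj x hxC hxS
      exact ⟨u, Finset.mem_insert_of_mem huC, hu⟩

lemma IsChainEnds.exists_kForceStep {S C E : Finset V} (h : IsChainEnds G S C E) :
    ∃ E', IsChainEnds G S (kForceStep G 1 C) E' := by
  suffices ∀ D : Finset V,
      (∀ w ∈ D, ∃ v ∈ C, G.Adj v w ∧ (G.neighborFinset v \ C).card ≤ 1) →
      ∃ E', IsChainEnds G S (C ∪ D) E' from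
    this _ fun w hw => (Finset.mem_filter.1 hw).2
  intro D
  induction D using Finset.induction_on with
  | empty => exact fun _ => ⟨E, by simpa using h⟩
  | insert w D _ ih =>
    intro hD
    obtain ⟨E', hE'⟩ := ih fun x hx => hD x (Finset.mem_insert_of_mem hx)
    obtain ⟨v, hv, hvw, hk⟩ := hD w (Finset.mem_insert_self _ _)
    rw [Finset.union_insert]
    by_cases hw : w ∈ C ∪ D
    · exact ⟨E', by rwa [Finset.insert_eq_of_mem hw]⟩
    · exact ⟨_, hE'.insert (Finset.mem_union_left _ hv) hw hvw
        ((Finset.card_le_card (Finset.sdiff_subset_sdiff subset_rfl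
          Finset.subset_union_left)).trans hk)⟩

/-- A zero forcing set contains at least half as many vertices as there are leaves. -/
lemma IsKForcingSet.card_leaves_le {S : Finset V} (hS : IsKForcingSet G 1 S) :
    (Finset.univ.filter (fun v : V => G.degree v = 1)).card ≤ 2 * S.card := by
  have key : ∀ i : ℕ, ∃ E, IsChainEnds G S ((kForceStep G 1)^[i] S) E := by
    intro i
    induction i with
    | zero =>
      exact ⟨S, le_rfl, fun v hv hv' => absurd hv hv', fun v hv hv' => absurd hv hv',
        fun v hv hv' => absurd hv hv'⟩
    | succ i ih =>
      obtain ⟨E, hE⟩ := ih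
      rw [Function.iterate_succ_apply']
      exact hE.exists_kForceStep
  obtain ⟨E, hE⟩ := key (Fintype.card V)
  rw [show (kForceStep G 1)^[Fintype.card V] S = Finset.univ from hS] at hE
  have hsub : Finset.univ.filter (fun v : V => G.degree v = 1) ⊆ S ∪ E := fun v hv => by
    by_cases hvS : v ∈ S
    · exact Finset.mem_union_left _ hvS
    · exact Finset.mem_union_right _
        (hE.leaf_mem v (Finset.mem_univ _) hvS (Finset.mem_filter.1 hv).2)
  have h1 := (Finset.card_le_card hsub).trans (Finset.card_union_le S E)
  have h2 := hE.card_le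
  omega

end KForcing

/-- Theorem: If `T` is a tree on `n ≥ 2` vertices with `n₁` leaves, then
`⌈n₁ / 2⌉ ≤ F_1(T) ≤ n₁ - 1`. -/
theorem zeroForcingNumber_tree_leaves {V : Type*} [Fintype V] [DecidableEq V]
    (T : SimpleGraph V) [DecidableRel T.Adj]
    (hT : T.IsTree) (hn : 2 ≤ Fintype.card V)
    (n₁ : ℕ) (hn₁ : n₁ = (Finset.univ.filter (fun v : V => T.degree v = 1)).card) :
    (n₁ + 1) / 2 ≤ kForcingNumber T 1 ∧ kForcingNumber T 1 ≤ n₁ - 1 := by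
  subst hn₁
  have : Nontrivial V := Fintype.one_lt_card_iff_nontrivial.1 hn
  constructor
  · obtain ⟨S, hS, hcard⟩ := exists_isKForcingSet_card_eq_kForcingNumber T 1
    have := hS.card_leaves_le
    omega
  · obtain ⟨r, hr⟩ := hT.exists_vert_degree_one_of_nontrivial
    rw [← Finset.card_erase_of_mem (Finset.mem_filter.2 ⟨Finset.mem_univ r, hr⟩)]
    exact kForcingNumber_le_card (isKForcingSet_leaves_erase hT r)
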